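/- Under Assumptions 1–3 (matrix form), the FedMuon-DA iterates satisfy, for every round t: E[Φ(X_{t+1})] − E[Φ(X_t)] ≤ −γ_x E[‖∇Φ(X_t)‖_F] + 2γ_x κ √(n_x) E[‖∇_Y f(X_t, Y_t)‖_F] + 2γ_x √(n_x) E[‖∇_X f(X_t, Y_t) − U_t‖_F] + 2γ_x √(n_x)·(1/(Np)) Σ_{n=1}^{N} Σ_{i=0}^{p−1} E[‖U_t − U^{(n)}_{t,i}‖_F] + L_Φ n_x γ_x²/2. -/

import Mathlib

open MeasureTheory Matrix

/-- Identify a point of `EuclideanSpace ℝ (Fin m × Fin n)` (whose norm is exactly the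
Frobenius norm) with an `m × n` matrix. -/
def euclToMatrix {m n : ℕ} (A : EuclideanSpace ℝ (Fin m × Fin n)) :
    Matrix (Fin m) (Fin n) ℝ :=
  Matrix.of fun i j => A (i, j)

open scoped InnerProductSpace

section Smooth

variable {E : Type*} [NormedAddCommGroup E] [InnerProductSpace ℝ E] [CompleteSpace E]

/-- The gradient gives the derivative along a line. -/
lemma HasGradientAt.hasDerivAt_line {g : E → ℝ} {G : E → E}
    (hg : ∀ x, HasGradientAt g (G x) x) (x d : E) (s : ℝ) :
    HasDerivAt (fun s : ℝ => g (x + s • d)) ⟪G (x + s • d), d⟫_ℝ s := by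
  have h1 : HasDerivAt (fun s : ℝ => x + s • d) d s := by
    simpa using ((hasDerivAt_id s).smul_const d).const_add x
  have h2 := (hg (x + s • d)).hasFDerivAt.comp_hasDerivAt s h1
  rwa [InnerProductSpace.toDual_apply_apply] at h2

/-- Quadratic upper bound for a function with Lipschitz gradient. -/
lemma le_quadratic_of_lipschitz_gradient {g : E → ℝ} {G : E → E} {L : ℝ}
    (hg : ∀ x, HasGradientAt g (G x) x) (hL : ∀ x y, ‖G x - G y‖ ≤ L * ‖x - y‖) (x y : E) :
    g y ≤ g x + ⟪G x, y - x⟫_ℝ + L / 2 * ‖y - x‖ ^ 2 := by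
  set d := y - x with hd
  have hderiv : ∀ s : ℝ, HasDerivAt
      (fun s : ℝ => g (x + s • d) - s * ⟪G x, d⟫_ℝ - L / 2 * ‖d‖ ^ 2 * s ^ 2)
      (⟪G (x + s • d), d⟫_ℝ - ⟪G x, d⟫_ℝ - L * ‖d‖ ^ 2 * s) s := by
    intro s
    have h := ((HasGradientAt.hasDerivAt_line hg x d s).sub
      ((hasDerivAt_id s).mul_const ⟪G x, d⟫_ℝ)).sub
      ((hasDerivAt_pow 2 s).const_mul (L / 2 * ‖d‖ ^ 2))
    refine h.congr_deriv ?_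
    norm_num
    ring
  have hanti : AntitoneOn
      (fun s : ℝ => g (x + s • d) - s * ⟪G x, d⟫_ℝ - L / 2 * ‖d‖ ^ 2 * s ^ 2) (Set.Icc 0 1) := by
    refine antitoneOn_of_deriv_nonpos (convex_Icc 0 1)
      (fun s _ => (hderiv s).continuousAt.continuousWithinAt)
      (fun s _ => (hderiv s).differentiableAt.differentiableWithinAt) ?_
    intro s hs
    rw [interior_Icc] at hs
    rw [(hderiv s).deriv, ← inner_sub_left]
    have h1 := real_inner_le_norm (G (x + s • d) - G x) d
    have h2 := hL (x + s • d) x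
    rw [add_sub_cancel_left, norm_smul, Real.norm_of_nonneg hs.1.le] at h2
    nlinarith [norm_nonneg d]
  have h := hanti (Set.left_mem_Icc.2 zero_le_one) (Set.right_mem_Icc.2 zero_le_one) zero_le_one
  simp only [one_smul, zero_smul, add_zero, hd, add_sub_cancel] at h
  rw [hd]
  linarith

/-- A differentiable minorant touching a differentiable function has the same gradient there. -/
lemma gradient_eq_of_le_of_eq {g h : E → ℝ} {a b x : E} (hg : HasGradientAt g a x)
    (hh : HasGradientAt h b x) (hle : ∀ y, g y ≤ h y) (heq : g x = h x) : a = b := by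
  have hmin : IsLocalMin (h - g) x := by
    refine Filter.Eventually.of_forall fun y => ?_
    simp only [Pi.sub_apply]
    linarith [hle y]
  have h0 := hmin.hasFDerivAt_eq_zero (hh.hasFDerivAt.sub hg.hasFDerivAt)
  exact ((InnerProductSpace.toDual ℝ E).injective (sub_eq_zero.1 h0)).symm

/-- Under the Polyak–Łojasiewicz inequality, maximizers lie within controlled distance. -/
lemma exists_maximizer_near_of_PL [FiniteDimensional ℝ E] {g : E → ℝ} {G : E → E} {M m c : ℝ}
    (hg : ∀ y, HasGradientAt g (G y) y) (hM : ∀ y, g y ≤ M)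
    (hPL : ∀ y, 2 * m * (M - g y) ≤ ‖G y‖ ^ 2) (hc : 0 < c) (hcm : 2 * c ^ 2 < m) (y : E) :
    ∃ z, g z = M ∧ c * ‖z - y‖ ≤ √(M - g y) := by
  have hgc : Continuous g := continuous_iff_continuousAt.2 fun y => (hg y).continuousAt
  have hcont : Continuous fun z => √(M - g z) + c * ‖z - y‖ := by fun_prop
  have hcoer : Filter.Tendsto (fun z => √(M - g z) + c * ‖z - y‖) (Filter.cocompact E)
      Filter.atTop := by
    refine Filter.tendsto_atTop_mono (f := fun z => c * (‖z‖ - ‖y‖)) ?_ ?_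
    · intro z
      have := norm_sub_norm_le z y
      nlinarith [Real.sqrt_nonneg (M - g z)]
    · exact Filter.Tendsto.const_mul_atTop hc
        (Filter.tendsto_atTop_add_const_right _ _ tendsto_norm_cocompact_atTop)
  obtain ⟨z, hz⟩ := hcont.exists_forall_le hcoer
  refine ⟨z, ?_, ?_⟩
  · by_contra hne
    have hgap : 0 < M - g z := sub_pos.2 (lt_of_le_of_ne (hM z) hne)
    have hsq := Real.sq_sqrt hgap.le
    have hspos := Real.sqrt_pos.2 hgap
    have hd : HasDerivAt (fun s : ℝ => √(M - g (z + s • G z)) + c * ‖G z‖ * s)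
        (-‖G z‖ ^ 2 / (2 * √(M - g z)) + c * ‖G z‖) 0 := by
      have h1 := (HasGradientAt.hasDerivAt_line hg z (G z) 0).const_sub M
      have h2 := h1.sqrt (by simpa using hgap.ne')
      have h3 := h2.add ((hasDerivAt_id (0 : ℝ)).const_mul (c * ‖G z‖))
      refine h3.congr_deriv ?_
      simp
    have hnonneg : 0 ≤ -‖G z‖ ^ 2 / (2 * √(M - g z)) + c * ‖G z‖ := by
      have hslope := hasDerivWithinAt_iff_tendsto_slope.1 (hd.hasDerivWithinAt (s := Set.Ioi 0))
      rw [Set.sdiff_singleton_eq_self (by simp)] at hslope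
      refine ge_of_tendsto hslope ?_
      filter_upwards [self_mem_nhdsWithin] with s hs
      have hs : 0 < s := hs
      rw [slope_def_field]
      refine div_nonneg ?_ (by linarith)
      have h1 := hz (z + s • G z)
      have h2 : ‖z + s • G z - y‖ ≤ ‖z - y‖ + s * ‖G z‖ := by
        calc ‖z + s • G z - y‖ = ‖(z - y) + s • G z‖ := by congr 1; abel
          _ ≤ _ := by
            simpa [norm_smul, abs_of_pos hs] using norm_add_le (z - y) (s • G z)
      simp only [zero_smul, add_zero, mul_zero]
      nlinarith
    have hm : 0 < m := by nlinarith
    have hG : 0 < ‖G z‖ := by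
      have := hPL z
      have : 0 < ‖G z‖ ^ 2 := by nlinarith [mul_pos hm hgap]
      exact lt_of_le_of_ne (norm_nonneg _) fun h => by simp [← h] at this
    have h3 : ‖G z‖ ≤ 2 * c * √(M - g z) := by
      have h4 : ‖G z‖ ^ 2 / (2 * √(M - g z)) ≤ c * ‖G z‖ := by
        rw [neg_div] at hnonneg; linarith
      rw [div_le_iff₀ (by positivity)] at h4
      nlinarith
    have h5 : ‖G z‖ ^ 2 ≤ 4 * c ^ 2 * (M - g z) := by
      calc ‖G z‖ ^ 2 ≤ (2 * c * √(M - g z)) ^ 2 := by gcongr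
        _ = _ := by rw [mul_pow, hsq]; ring
    nlinarith [hPL z]
  · have := hz y
    simp only [sub_self, norm_zero, mul_zero, add_zero] at this
    linarith [Real.sqrt_nonneg (M - g z)]

end Smooth

section Primal

variable {E F : Type*} [NormedAddCommGroup E] [InnerProductSpace ℝ E] [CompleteSpace E]
  [NormedAddCommGroup F] [InnerProductSpace ℝ F] [CompleteSpace F]
  {f : E → F → ℝ} {Gx : E → F → E} {Gy : E → F → F} {Ystar : E → F} {Phi : E → ℝ} {GPhi : E → E}
  {L m : ℝ}

/-- Gap between the primal gradient and the partial gradient under the PL condition. -/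
lemma norm_primal_gradient_sub_le [FiniteDimensional ℝ F] (hL : 0 < L) (hm : 0 < m)
    (hGx : ∀ x y, HasGradientAt (fun x' => f x' y) (Gx x y) x)
    (hGy : ∀ x y, HasGradientAt (f x) (Gy x y) y)
    (hLipxy : ∀ x y y', ‖Gx x y - Gx x y'‖ ≤ L * ‖y - y'‖)
    (hmax : ∀ x y, f x y ≤ Phi x) (hPL : ∀ x y, 2 * m * (Phi x - f x y) ≤ ‖Gy x y‖ ^ 2)
    (hGPhi : ∀ x, HasGradientAt Phi (GPhi x) x) (x : E) (y : F) :
    ‖GPhi x - Gx x y‖ ≤ L / m * ‖Gy x y‖ := by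
  have hc0 : 0 < √(m / 2) := Real.sqrt_pos.2 (by positivity)
  have hc0sq : √(m / 2) ^ 2 = m / 2 := Real.sq_sqrt (by positivity)
  have key : ∀ c ∈ Set.Ioo 0 (√(m / 2)), c * ‖GPhi x - Gx x y‖ ≤ L * √(Phi x - f x y) := by
    rintro c ⟨hc, hc'⟩
    obtain ⟨z, hz, hzy⟩ := exists_maximizer_near_of_PL (hGy x) (hmax x) (hPL x) hc
      (by nlinarith) y
    rw [← gradient_eq_of_le_of_eq (hGx x z) (hGPhi x) (fun x' => hmax x' z) hz]
    nlinarith [hLipxy x z y]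
  have hlim : √(m / 2) * ‖GPhi x - Gx x y‖ ≤ L * √(Phi x - f x y) := by
    have ht : Filter.Tendsto (fun c : ℝ => c * ‖GPhi x - Gx x y‖)
        (nhdsWithin (√(m / 2)) (Set.Iio (√(m / 2)))) (nhds (√(m / 2) * ‖GPhi x - Gx x y‖)) :=
      ((continuous_id.mul continuous_const).tendsto _).mono_left nhdsWithin_le_nhds
    refine le_of_tendsto ht ?_
    filter_upwards [Ioo_mem_nhdsLT hc0] with c hc using key c hc
  have hgap : 0 ≤ Phi x - f x y := sub_nonneg.2 (hmax x y)
  have h1 : 2 * √(m / 2) * √(Phi x - f x y) ≤ ‖Gy x y‖ := by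
    refine abs_le_of_sq_le_sq' ?_ (norm_nonneg _) |>.2
    rw [mul_pow, mul_pow, hc0sq, Real.sq_sqrt hgap]
    linarith [hPL x y]
  rw [div_mul_eq_mul_div, le_div_iff₀ hm]
  have h2 : m = 2 * √(m / 2) ^ 2 := by rw [hc0sq]; ring
  rw [h2]
  nlinarith

/-- Quadratic upper bound for the primal function under the PL condition. -/
lemma primal_le_quadratic (hm : 0 < m)
    (hGx : ∀ x y, HasGradientAt (fun x' => f x' y) (Gx x y) x)
    (hGy : ∀ x y, HasGradientAt (f x) (Gy x y) y)
    (hLipxx : ∀ x x' y, ‖Gx x y - Gx x' y‖ ≤ L * ‖x - x'‖)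
    (hLipyx : ∀ x x' y, ‖Gy x y - Gy x' y‖ ≤ L * ‖x - x'‖)
    (hmax : ∀ x y, f x y ≤ Phi x) (hatt : ∀ x, f x (Ystar x) = Phi x)
    (hPL : ∀ x y, 2 * m * (Phi x - f x y) ≤ ‖Gy x y‖ ^ 2)
    (hGPhi : ∀ x, HasGradientAt Phi (GPhi x) x) (x x' : E) :
    Phi x' ≤ Phi x + ⟪GPhi x, x' - x⟫_ℝ + (L + L ^ 2 / m) / 2 * ‖x' - x‖ ^ 2 := by
  have h0 : Gy x (Ystar x) = 0 := by
    exact gradient_eq_of_le_of_eq (hGy x (Ystar x)) (hasGradientAt_const _ (Phi x)) (hmax x)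
      (hatt x)
  have h1 := hLipyx x' x (Ystar x)
  rw [h0, sub_zero] at h1
  have h2 : ‖Gy x' (Ystar x)‖ ^ 2 ≤ (L * ‖x' - x‖) ^ 2 := by gcongr
  have h3 := hPL x' (Ystar x)
  have h4 := le_quadratic_of_lipschitz_gradient (g := fun x' => f x' (Ystar x))
    (fun a => hGx a (Ystar x)) (fun a b => hLipxx a b (Ystar x)) x x'
  rw [gradient_eq_of_le_of_eq (hGx x (Ystar x)) (hGPhi x) (fun x' => hmax x' _) (hatt x),
    hatt x] at h4
  have h5 : Phi x' - f x' (Ystar x) ≤ L ^ 2 / m / 2 * ‖x' - x‖ ^ 2 := by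
    have : L ^ 2 / m / 2 * ‖x' - x‖ ^ 2 = (L * ‖x' - x‖) ^ 2 / (2 * m) := by field_simp
    rw [this, le_div_iff₀ (by positivity)]
    linarith
  linarith

/-- The primal gradient is Lipschitz, hence continuous, under the PL condition. -/
lemma continuous_primal_gradient (hL : 0 < L) (hm : 0 < m)
    (hGx : ∀ x y, HasGradientAt (fun x' => f x' y) (Gx x y) x)
    (hGy : ∀ x y, HasGradientAt (f x) (Gy x y) y)
    (hLipxx : ∀ x x' y, ‖Gx x y - Gx x' y‖ ≤ L * ‖x - x'‖)
    (hLipyx : ∀ x x' y, ‖Gy x y - Gy x' y‖ ≤ L * ‖x - x'‖)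
    (hmax : ∀ x y, f x y ≤ Phi x) (hatt : ∀ x, f x (Ystar x) = Phi x)
    (hGPhi : ∀ x, HasGradientAt Phi (GPhi x) x)
    (hgap : ∀ x y, ‖GPhi x - Gx x y‖ ≤ L / m * ‖Gy x y‖) : Continuous GPhi := by
  refine (LipschitzWith.of_dist_le_mul (K := (L / m * L + L).toNNReal) fun x' x => ?_).continuous
  rw [Real.coe_toNNReal _ (by positivity), dist_eq_norm, dist_eq_norm]
  have h0 : Gy x (Ystar x) = 0 :=
    gradient_eq_of_le_of_eq (hGy x (Ystar x)) (hasGradientAt_const _ (Phi x)) (hmax x) (hatt x)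
  have h1 := hLipyx x' x (Ystar x)
  rw [h0, sub_zero] at h1
  have h2 := hLipxx x' x (Ystar x)
  rw [gradient_eq_of_le_of_eq (hGx x (Ystar x)) (hGPhi x) (fun x' => hmax x' _) (hatt x)] at h2
  calc ‖GPhi x' - GPhi x‖ ≤ ‖GPhi x' - Gx x' (Ystar x)‖ + ‖Gx x' (Ystar x) - GPhi x‖ :=
        norm_sub_le_norm_sub_add_norm_sub _ _ _
    _ ≤ L / m * (L * ‖x' - x‖) + L * ‖x' - x‖ := by
        gcongr
        exact (hgap x' (Ystar x)).trans (by gcongr)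
    _ = (L / m * L + L) * ‖x' - x‖ := by ring

end Primal

section Muon

lemma inner_eq_trace_euclToMatrix {m n : ℕ} (A B : EuclideanSpace ℝ (Fin m × Fin n)) :
    ⟪A, B⟫_ℝ = ((euclToMatrix A)ᵀ * euclToMatrix B).trace := by
  simp only [PiLp.inner_apply, RCLike.inner_apply, conj_trivial, Matrix.trace, Matrix.diag,
    Matrix.mul_apply, Matrix.transpose_apply, euclToMatrix, Matrix.of_apply,
    Fintype.sum_prod_type_right]
  exact Finset.sum_congr rfl fun _ _ => Finset.sum_congr rfl fun _ _ => mul_comm _ _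

/-- A Muon step moves along a direction of norm at most `√n` that norms the momentum. -/
lemma exists_muon_direction {m n : ℕ} {U X X' : EuclideanSpace ℝ (Fin m × Fin n)} {η : ℝ}
    (h : ∃ (r : ℕ) (P : Matrix (Fin m) (Fin r) ℝ) (Q : Matrix (Fin n) (Fin r) ℝ) (sv : Fin r → ℝ),
      Pᵀ * P = 1 ∧ Qᵀ * Q = 1 ∧ (∀ j, 0 < sv j) ∧
      euclToMatrix U = P * Matrix.diagonal sv * Qᵀ ∧
      euclToMatrix X' = euclToMatrix X - η • (P * Qᵀ)) :
    ∃ D : EuclideanSpace ℝ (Fin m × Fin n), X' = X - η • D ∧ ‖D‖ ≤ √n ∧ ‖U‖ ≤ ⟪U, D⟫_ℝ := by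
  obtain ⟨r, P, Q, sv, hP, hQ, hsv, hU, hX⟩ := h
  set D : EuclideanSpace ℝ (Fin m × Fin n) := WithLp.toLp 2 fun k => (P * Qᵀ) k.1 k.2
  have hD : euclToMatrix D = P * Qᵀ := rfl
  have hrn : r ≤ n := by
    have h1 := Matrix.rank_mul_le_right Qᵀ Q
    rw [hQ, Matrix.rank_one, Fintype.card_fin] at h1
    simpa using h1.trans (Matrix.rank_le_card_height Q)
  have hcyc : ∀ A B : Matrix (Fin r) (Fin r) ℝ,
      ((P * A * Qᵀ)ᵀ * (P * B * Qᵀ)).trace = (Aᵀ * B).trace := by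
    intro A B
    have : (P * A * Qᵀ)ᵀ * (P * B * Qᵀ) = Q * (Aᵀ * (Pᵀ * P) * B * Qᵀ) := by
      simp only [Matrix.transpose_mul, Matrix.transpose_transpose, Matrix.mul_assoc]
    rw [this, Matrix.trace_mul_comm, hP, Matrix.mul_one, Matrix.mul_assoc, hQ, Matrix.mul_one]
  have hDone : euclToMatrix D = P * (1 : Matrix (Fin r) (Fin r) ℝ) * Qᵀ := by rw [hD, Matrix.mul_one]
  refine ⟨D, ?_, ?_, ?_⟩
  · ext ⟨i, j⟩
    exact congrFun (congrFun hX i) j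
  · refine Real.le_sqrt_of_sq_le ?_
    rw [← real_inner_self_eq_norm_sq, inner_eq_trace_euclToMatrix, hDone, hcyc]
    simpa using hrn
  · rw [inner_eq_trace_euclToMatrix, hU, hDone, hcyc]
    have hUU : ‖U‖ ^ 2 = ∑ j, sv j ^ 2 := by
      rw [← real_inner_self_eq_norm_sq, inner_eq_trace_euclToMatrix, hU, hcyc]
      simp [Matrix.trace, pow_two]
    have htr : ((Matrix.diagonal sv)ᵀ * 1).trace = ∑ j, sv j := by simp [Matrix.trace]
    rw [htr]
    have hnn : 0 ≤ ∑ j, sv j := Finset.sum_nonneg fun j _ => (hsv j).le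
    refine abs_le_of_sq_le_sq' ?_ hnn |>.2
    rw [hUU]
    exact Finset.sum_sq_le_sq_sum_of_nonneg fun j _ => (hsv j).le

end Muon

section Averages

variable {E : Type*} [NormedAddCommGroup E] [InnerProductSpace ℝ E]

/-- Alignment estimate for a direction that norms `u`. -/
lemma neg_inner_le_of_norm_le_inner {a u D : E} {r : ℝ} (hr : 1 ≤ r) (hD : ‖D‖ ≤ r)
    (hu : ‖u‖ ≤ ⟪u, D⟫_ℝ) : -⟪a, D⟫_ℝ ≤ -‖a‖ + 2 * r * ‖a - u‖ := by
  have h1 : ⟪a, D⟫_ℝ = ⟪u, D⟫_ℝ + ⟪a - u, D⟫_ℝ := by rw [inner_sub_left]; ring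
  have h2 := neg_le_of_abs_le (abs_real_inner_le_norm (a - u) D)
  have h3 := norm_sub_norm_le a u
  have h4 := norm_nonneg (a - u)
  nlinarith

lemma HasGradientAt.const_mul_sum [CompleteSpace E] {ι : Type*} [Fintype ι] {g : ι → E → ℝ}
    {G : ι → E} {x : E} (c : ℝ) (h : ∀ i, HasGradientAt (g i) (G i) x) :
    HasGradientAt (fun y => c * ∑ i, g i y) (c • ∑ i, G i) x := by
  rw [hasGradientAt_iff_hasFDerivAt]
  have h1 := (HasFDerivAt.fun_sum fun i (_ : i ∈ Finset.univ) => (h i).hasFDerivAt).const_mul c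
  simpa [map_sum, map_smul] using h1

lemma norm_average_sub_average_le {N : ℕ} (hN : 0 < N) {a b : Fin N → E} {C : ℝ}
    (h : ∀ n, ‖a n - b n‖ ≤ C) :
    ‖(N : ℝ)⁻¹ • ∑ n, a n - (N : ℝ)⁻¹ • ∑ n, b n‖ ≤ C := by
  have hN' : (0 : ℝ) < N := Nat.cast_pos.2 hN
  rw [← smul_sub, ← Finset.sum_sub_distrib, norm_smul, Real.norm_of_nonneg (by positivity),
    inv_mul_le_iff₀ hN']
  simpa using norm_sum_le_of_le Finset.univ fun n _ => h n

/-- Summing the increments of the local steps. -/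
lemma sub_eq_neg_smul_sum_of_step {x D : ℕ → E} {η : ℝ} {p : ℕ}
    (h : ∀ i < p, x (i + 1) = x i - η • D i) :
    x p - x 0 = -(η • ∑ i ∈ Finset.range p, D i) := by
  rw [← Finset.sum_range_sub, Finset.smul_sum, ← Finset.sum_neg_distrib]
  refine Finset.sum_congr rfl fun i hi => ?_
  rw [h i (Finset.mem_range.1 hi)]
  abel

lemma norm_average_double_sum_le {N p : ℕ} (hN : 0 < N) (hp : 0 < p) {D : Fin N → ℕ → E} {r γ : ℝ}
    (hγ : 0 < γ) (hD : ∀ n, ∀ i < p, ‖D n i‖ ≤ r) :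
    ‖(γ / (N * p)) • ∑ n, ∑ i ∈ Finset.range p, D n i‖ ≤ γ * r := by
  have hN' : (0 : ℝ) < N := Nat.cast_pos.2 hN
  have hp' : (0 : ℝ) < p := Nat.cast_pos.2 hp
  have h : ‖∑ n, ∑ i ∈ Finset.range p, D n i‖ ≤ N * (p * r) := by
    refine (norm_sum_le_of_le Finset.univ fun n _ =>
      norm_sum_le_of_le (Finset.range p) fun i hi => hD n i (Finset.mem_range.1 hi)).trans ?_
    simp
  rw [norm_smul, Real.norm_of_nonneg (by positivity), div_mul_eq_mul_div,
    div_le_iff₀ (by positivity)]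
  calc γ * ‖∑ n, ∑ i ∈ Finset.range p, D n i‖ ≤ γ * (N * (p * r)) := by gcongr
    _ = γ * r * (N * p) := by ring

/-- Descent along an averaged normalized direction. -/
lemma inner_neg_average_le {N p : ℕ} (hN : 0 < N) (hp : 0 < p) {D U : Fin N → ℕ → E} {a b u : E}
    {r γ C : ℝ} (hγ : 0 < γ) (hr : 0 ≤ r) (hab : ‖a - b‖ ≤ C)
    (hD : ∀ n, ∀ i < p, -⟪a, D n i⟫_ℝ ≤ -‖a‖ + 2 * r * ‖a - U n i‖) :
    ⟪a, -((γ / (N * p)) • ∑ n, ∑ i ∈ Finset.range p, D n i)⟫_ℝ ≤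
      -(γ * ‖a‖) + 2 * γ * r * C + 2 * γ * r * ‖b - u‖
        + 2 * γ * r * (((1 : ℝ) / (N * p)) * ∑ n, ∑ i ∈ Finset.range p, ‖u - U n i‖) := by
  have hN' : (0 : ℝ) < N := Nat.cast_pos.2 hN
  have hp' : (0 : ℝ) < p := Nat.cast_pos.2 hp
  have h1 : ∀ n, ∀ i < p, -⟪a, D n i⟫_ℝ ≤
      (-‖a‖ + 2 * r * (C + ‖b - u‖)) + 2 * r * ‖u - U n i‖ := by
    intro n i hi
    have h2 : ‖a - U n i‖ ≤ C + ‖b - u‖ + ‖u - U n i‖ := by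
      have h3 := norm_sub_le_norm_sub_add_norm_sub a b (U n i)
      have h4 := norm_sub_le_norm_sub_add_norm_sub b u (U n i)
      linarith
    nlinarith [hD n i hi, mul_le_mul_of_nonneg_left h2 hr]
  have h2 : ∑ n, ∑ i ∈ Finset.range p, -⟪a, D n i⟫_ℝ ≤
      N * (p * (-‖a‖ + 2 * r * (C + ‖b - u‖)))
        + 2 * r * ∑ n, ∑ i ∈ Finset.range p, ‖u - U n i‖ := by
    refine (Finset.sum_le_sum fun n _ => Finset.sum_le_sum fun i hi =>
      h1 n i (Finset.mem_range.1 hi)).trans_eq ?_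
    simp only [Finset.sum_add_distrib, Finset.sum_const, Finset.card_univ, Fintype.card_fin,
      Finset.card_range, nsmul_eq_mul, Finset.mul_sum]
    ring
  calc ⟪a, -((γ / (N * p)) • ∑ n, ∑ i ∈ Finset.range p, D n i)⟫_ℝ
      = γ / (N * p) * ∑ n, ∑ i ∈ Finset.range p, -⟪a, D n i⟫_ℝ := by
        simp only [inner_neg_right, inner_smul_right, inner_sum, Finset.sum_neg_distrib, mul_neg]
    _ ≤ γ / (N * p) * (N * (p * (-‖a‖ + 2 * r * (C + ‖b - u‖)))
        + 2 * r * ∑ n, ∑ i ∈ Finset.range p, ‖u - U n i‖) := by gcongr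
    _ = _ := by field_simp; ring

end Averages

section Measure

/-- A continuous function of a bounded random vector is integrable. -/
lemma Continuous.integrable_comp_of_bounded {Ω E G : Type*} {mΩ : MeasurableSpace Ω}
    {μ : Measure Ω} [IsFiniteMeasure μ] [NormedAddCommGroup E] [ProperSpace E]
    [NormedAddCommGroup G] {φ : E → G} (hφ : Continuous φ) {Z : Ω → E}
    (hZ : StronglyMeasurable Z) {B : ℝ} (hB : ∀ ω, ‖Z ω‖ ≤ B) :
    Integrable (fun ω => φ (Z ω)) μ := by
  obtain ⟨C, hC⟩ := (isCompact_closedBall (0 : E) B).exists_bound_of_continuousOn hφ.continuousOn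
  exact Integrable.of_bound (hφ.comp_stronglyMeasurable hZ).aestronglyMeasurable C
    (Filter.Eventually.of_forall fun ω => hC _ (by simpa using hB ω))

lemma continuous_uncurry_of_norm_sub_le {E F G : Type*} [NormedAddCommGroup E]
    [NormedAddCommGroup F] [NormedAddCommGroup G] {φ : E → F → G} {L : ℝ} (hL : 0 ≤ L)
    (h : ∀ x y x' y', ‖φ x y - φ x' y'‖ ≤ L * √(‖x - x'‖ ^ 2 + ‖y - y'‖ ^ 2)) :
    Continuous (Function.uncurry φ) := by
  refine (LipschitzWith.of_dist_le_mul (K := (L * 2).toNNReal) fun z w => ?_).continuous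
  rw [Real.coe_toNNReal _ (by positivity), dist_eq_norm, dist_eq_norm, mul_assoc]
  refine (h z.1 z.2 w.1 w.2).trans (mul_le_mul_of_nonneg_left ?_ hL)
  refine Real.sqrt_le_iff.2 ⟨by positivity, ?_⟩
  have h1 : ‖z.1 - w.1‖ ≤ ‖z - w‖ := norm_fst_le (z - w)
  have h2 : ‖z.2 - w.2‖ ≤ ‖z - w‖ := norm_snd_le (z - w)
  nlinarith [norm_nonneg (z.1 - w.1), norm_nonneg (z.2 - w.2), norm_nonneg (z - w)]

lemma norm_iterate_bounded {Ω E : Type*} [NormedAddCommGroup E] {Z : ℕ → Ω → E} {C : ℝ} {z : E}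
    (h0 : Z 0 = fun _ => z) (h : ∀ t ω, ‖Z (t + 1) ω - Z t ω‖ ≤ C) (t : ℕ) :
    ∃ B, ∀ ω, ‖Z t ω‖ ≤ B := by
  induction t with
  | zero => exact ⟨‖z‖, fun ω => by rw [h0]⟩
  | succ t ih =>
    obtain ⟨B, hB⟩ := ih
    refine ⟨B + C, fun ω => ?_⟩
    have := norm_le_norm_add_norm_sub' (Z (t + 1) ω) (Z t ω)
    linarith [hB ω, h t ω]

lemma integrable_smul_add_smul {Ω E : Type*} {mΩ : MeasurableSpace Ω} {μ : Measure Ω}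
    [NormedAddCommGroup E] [NormedSpace ℝ E] {a b : Ω → E} (ha : Integrable a μ)
    (hb : Integrable b μ) (c d : ℝ) : Integrable (fun ω => c • a ω + d • b ω) μ :=
  (ha.smul c).add (hb.smul d)

/-- Integrating an affine pointwise bound. -/
lemma integral_sub_le_of_forall_le {Ω : Type*} {mΩ : MeasurableSpace Ω} {μ : Measure Ω}
    [IsProbabilityMeasure μ] {N p : ℕ} {A A' g₁ g₂ g₃ : Ω → ℝ} {h : Fin N → ℕ → Ω → ℝ}
    (hA : Integrable A μ) (hA' : Integrable A' μ) (hg₁ : Integrable g₁ μ) (hg₂ : Integrable g₂ μ)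
    (hg₃ : Integrable g₃ μ) (hh : ∀ n i, Integrable (h n i) μ) {c₁ c₂ c₃ c₄ c₅ K : ℝ}
    (hle : ∀ ω, A' ω - A ω ≤ -(c₁ * g₁ ω) + c₂ * g₂ ω + c₃ * g₃ ω
      + c₄ * (c₅ * ∑ n, ∑ i ∈ Finset.range p, h n i ω) + K) :
    (∫ ω, A' ω ∂μ) - ∫ ω, A ω ∂μ ≤ -(c₁ * ∫ ω, g₁ ω ∂μ) + c₂ * ∫ ω, g₂ ω ∂μ
      + c₃ * ∫ ω, g₃ ω ∂μ + c₄ * (c₅ * ∑ n, ∑ i ∈ Finset.range p, ∫ ω, h n i ω ∂μ) + K := by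
  have hs : ∀ n, Integrable (fun ω => ∑ i ∈ Finset.range p, h n i ω) μ := fun n =>
    integrable_finsetSum _ fun i _ => hh n i
  have h1 : Integrable (fun ω => -(c₁ * g₁ ω)) μ := (hg₁.const_mul c₁).neg
  have h2 : Integrable (fun ω => -(c₁ * g₁ ω) + c₂ * g₂ ω) μ := h1.add (hg₂.const_mul c₂)
  have h3 : Integrable (fun ω => -(c₁ * g₁ ω) + c₂ * g₂ ω + c₃ * g₃ ω) μ :=
    h2.add (hg₃.const_mul c₃)
  have h4 : Integrable (fun ω => c₄ * (c₅ * ∑ n, ∑ i ∈ Finset.range p, h n i ω)) μ :=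
    ((integrable_finsetSum _ fun n _ => hs n).const_mul c₅).const_mul c₄
  have h5 : Integrable (fun ω => -(c₁ * g₁ ω) + c₂ * g₂ ω + c₃ * g₃ ω
      + c₄ * (c₅ * ∑ n, ∑ i ∈ Finset.range p, h n i ω)) μ := h3.add h4
  rw [← integral_sub hA' hA]
  refine (integral_mono (hA'.sub hA) (h5.add (integrable_const K)) hle).trans_eq ?_
  simp only [Pi.add_apply]
  rw [integral_add h5 (integrable_const K), integral_add h3 h4,
    integral_add h2 (hg₃.const_mul c₃), integral_add h1 (hg₂.const_mul c₂), integral_neg]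
  simp only [integral_const_mul, integral_const, probReal_univ, one_smul]
  rw [integral_finsetSum _ fun n _ => hs n]
  simp only [integral_finsetSum _ fun i _ => hh _ i]

end Measure

/-- Averaged Muon steps as one step along an average of normalized directions. -/
lemma exists_muon_directions {m n N p : ℕ} (hp : 0 < p) (hN : 0 < N) {η γ : ℝ} (hη : η ≠ 0)
    {x x' : EuclideanSpace ℝ (Fin m × Fin n)} {U X : Fin N → ℕ → EuclideanSpace ℝ (Fin m × Fin n)}
    (h0 : ∀ k, X k 0 = x)
    (hstep : ∀ k i, i < p → ∃ (r : ℕ) (P : Matrix (Fin m) (Fin r) ℝ)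
      (Q : Matrix (Fin n) (Fin r) ℝ) (sv : Fin r → ℝ),
      Pᵀ * P = 1 ∧ Qᵀ * Q = 1 ∧ (∀ j, 0 < sv j) ∧
      euclToMatrix (U k i) = P * Matrix.diagonal sv * Qᵀ ∧
      euclToMatrix (X k (i + 1)) = euclToMatrix (X k i) - η • (P * Qᵀ))
    (hx' : x' = x + (γ / (η * N * p)) • ∑ k, (X k p - x)) :
    ∃ D : Fin N → ℕ → EuclideanSpace ℝ (Fin m × Fin n),
      (∀ k, ∀ i < p, ‖D k i‖ ≤ √n ∧ ‖U k i‖ ≤ ⟪U k i, D k i⟫_ℝ) ∧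
      x' - x = -((γ / (N * p)) • ∑ k, ∑ i ∈ Finset.range p, D k i) := by
  have hex : ∀ k i, ∃ D, i < p → X k (i + 1) = X k i - η • D ∧ ‖D‖ ≤ √n ∧
      ‖U k i‖ ≤ ⟪U k i, D⟫_ℝ := by
    intro k i
    by_cases hi : i < p
    · obtain ⟨D, hD⟩ := exists_muon_direction (hstep k i hi)
      exact ⟨D, fun _ => hD⟩
    · exact ⟨0, fun h => absurd h hi⟩
  choose D hD using hex
  refine ⟨D, fun k i hi => (hD k i hi).2, ?_⟩
  have hsum : ∀ k, X k p - x = -(η • ∑ i ∈ Finset.range p, D k i) := fun k => by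
    rw [← h0 k]
    exact sub_eq_neg_smul_sum_of_step fun i hi => (hD k i hi).1
  have hN' : (N : ℝ) ≠ 0 := Nat.cast_ne_zero.2 hN.ne'
  have hp' : (p : ℝ) ≠ 0 := Nat.cast_ne_zero.2 hp.ne'
  rw [hx', add_sub_cancel_left, Finset.sum_congr rfl fun k _ => hsum k, Finset.sum_neg_distrib,
    ← Finset.smul_sum, smul_neg, smul_smul]
  congr 2
  field_simp

/-- Alignment estimate for a Muon direction, including the degenerate width zero. -/
lemma neg_inner_le_of_muon_direction {m n : ℕ} {a u D : EuclideanSpace ℝ (Fin m × Fin n)}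
    (hD : ‖D‖ ≤ √n) (hu : ‖u‖ ≤ ⟪u, D⟫_ℝ) : -⟪a, D⟫_ℝ ≤ -‖a‖ + 2 * √n * ‖a - u‖ := by
  rcases Nat.eq_zero_or_pos n with rfl | hn
  · have ha : a = 0 := Subsingleton.elim _ _
    simp [ha]
  · exact neg_inner_le_of_norm_le_inner (Real.one_le_sqrt.2 (by exact_mod_cast hn)) hD hu

set_option maxHeartbeats 1000000 in
/-- descent of Φ along FedMuon-DA, matrix form: for every round `t`,
`E[Φ(X_{t+1})] − E[Φ(X_t)] ≤ −γₓ E‖∇Φ(X_t)‖_F + 2γₓκ√nₓ E‖∇_Y f(X_t,Y_t)‖_F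
+ 2γₓ√nₓ E‖∇_X f(X_t,Y_t) − U_t‖_F + 2γₓ√nₓ (1/(Np)) ∑_{n,i} E‖U_t − U⁽ⁿ⁾_{t,i}‖_F
+ L_Φ nₓ γₓ²/2`, with `κ = L_f/μ`, `L_Φ = L_f + L_f²/μ`. -/
theorem fedmuon_da_phi_descent
    {mx nx my ny : ℕ} {Ω : Type} {mΩ : MeasurableSpace Ω}
    (μ : Measure Ω) [IsProbabilityMeasure μ]
    (F : Filtration ℕ mΩ)
    (N p : ℕ) (hN : 0 < N) (hp : 0 < p)
    (Lf mupl sigma s : ℝ) (hLf : 0 < Lf) (hmupl : 0 < mupl) (hsigma : 0 < sigma)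
    (hs1 : 1 < s) (hs2 : s ≤ 2)
    (gammax gammay etax etay betax betay : ℝ)
    (hgammax : 0 < gammax) (hgammay : 0 < gammay)
    (hetax : 0 < etax) (hetay : 0 < etay)
    (hbetax0 : 0 < betax) (hbetax1 : betax < 1)
    (hbetay0 : 0 < betay) (hbetay1 : betay < 1)
    -- Assumption 1 (smoothness): component losses on matrix variables (identified
    -- with points of a Euclidean space carrying the Frobenius norm), their partial
    -- gradients, and joint `Lf`-Lipschitzness of the full gradients
    (f : Fin N → EuclideanSpace ℝ (Fin mx × Fin nx) → EuclideanSpace ℝ (Fin my × Fin ny) → ℝ)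
    (Gx : Fin N → EuclideanSpace ℝ (Fin mx × Fin nx) → EuclideanSpace ℝ (Fin my × Fin ny) → EuclideanSpace ℝ (Fin mx × Fin nx))
    (Gy : Fin N → EuclideanSpace ℝ (Fin mx × Fin nx) → EuclideanSpace ℝ (Fin my × Fin ny) → EuclideanSpace ℝ (Fin my × Fin ny))
    (hGx : ∀ n X Y, HasGradientAt (fun X' => f n X' Y) (Gx n X Y) X)
    (hGy : ∀ n X Y, HasGradientAt (fun Y' => f n X Y') (Gy n X Y) Y)
    (hLip : ∀ n X Y X' Y',
      Real.sqrt (‖Gx n X Y - Gx n X' Y'‖ ^ 2 + ‖Gy n X Y - Gy n X' Y'‖ ^ 2) ≤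
        Lf * Real.sqrt (‖X - X'‖ ^ 2 + ‖Y - Y'‖ ^ 2))
    -- the global objective `f = (1/N) ∑ f⁽ⁿ⁾` and its partial gradients
    (fbar : EuclideanSpace ℝ (Fin mx × Fin nx) → EuclideanSpace ℝ (Fin my × Fin ny) → ℝ)
    (hfbar : ∀ X Y, fbar X Y = (N : ℝ)⁻¹ * ∑ n, f n X Y)
    (Gxbar : EuclideanSpace ℝ (Fin mx × Fin nx) → EuclideanSpace ℝ (Fin my × Fin ny) → EuclideanSpace ℝ (Fin mx × Fin nx))
    (hGxbar : ∀ X Y, Gxbar X Y = (N : ℝ)⁻¹ • ∑ n, Gx n X Y)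
    (Gybar : EuclideanSpace ℝ (Fin mx × Fin nx) → EuclideanSpace ℝ (Fin my × Fin ny) → EuclideanSpace ℝ (Fin my × Fin ny))
    (hGybar : ∀ X Y, Gybar X Y = (N : ℝ)⁻¹ • ∑ n, Gy n X Y)
    -- Assumption 2 (PL condition in Y, with maximizer selection `Ystar`)
    (Ystar : EuclideanSpace ℝ (Fin mx × Fin nx) → EuclideanSpace ℝ (Fin my × Fin ny))
    (hYstar : ∀ X Y, fbar X Y ≤ fbar X (Ystar X))
    (hPL : ∀ X Y, 2 * mupl * (fbar X (Ystar X) - fbar X Y) ≤ ‖Gybar X Y‖ ^ 2)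
    -- the primal function Φ(X) = max_Y f(X,Y) and its gradient
    (Phi : EuclideanSpace ℝ (Fin mx × Fin nx) → ℝ)
    (hPhi : ∀ X, Phi X = fbar X (Ystar X))
    (GPhi : EuclideanSpace ℝ (Fin mx × Fin nx) → EuclideanSpace ℝ (Fin mx × Fin nx))
    (hGPhi : ∀ X, HasGradientAt Phi (GPhi X) X)
    -- the random processes generated by FedMuon-DA
    (Xg : ℕ → Ω → EuclideanSpace ℝ (Fin mx × Fin nx)) (Yg : ℕ → Ω → EuclideanSpace ℝ (Fin my × Fin ny))
    (Xl : Fin N → ℕ → ℕ → Ω → EuclideanSpace ℝ (Fin mx × Fin nx))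
    (Yl : Fin N → ℕ → ℕ → Ω → EuclideanSpace ℝ (Fin my × Fin ny))
    (Ul : Fin N → ℕ → ℕ → Ω → EuclideanSpace ℝ (Fin mx × Fin nx))
    (Vl : Fin N → ℕ → ℕ → Ω → EuclideanSpace ℝ (Fin my × Fin ny))
    (Ug : ℕ → Ω → EuclideanSpace ℝ (Fin mx × Fin nx)) (Vg : ℕ → Ω → EuclideanSpace ℝ (Fin my × Fin ny))
    (Dx : Fin N → ℕ → ℕ → Ω → EuclideanSpace ℝ (Fin mx × Fin nx))
    (Dy : Fin N → ℕ → ℕ → Ω → EuclideanSpace ℝ (Fin my × Fin ny))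
    (gXl : Fin N → ℕ → Ω → EuclideanSpace ℝ (Fin mx × Fin nx))
    (gYl : Fin N → ℕ → Ω → EuclideanSpace ℝ (Fin my × Fin ny))
    (gXg : ℕ → Ω → EuclideanSpace ℝ (Fin mx × Fin nx)) (gYg : ℕ → Ω → EuclideanSpace ℝ (Fin my × Fin ny))
    (Uinit : Ω → EuclideanSpace ℝ (Fin mx × Fin nx)) (Vinit : Ω → EuclideanSpace ℝ (Fin my × Fin ny))
    (gXinit : Ω → EuclideanSpace ℝ (Fin mx × Fin nx)) (gYinit : Ω → EuclideanSpace ℝ (Fin my × Fin ny))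
    (gXlinit : Fin N → Ω → EuclideanSpace ℝ (Fin mx × Fin nx))
    (gYlinit : Fin N → Ω → EuclideanSpace ℝ (Fin my × Fin ny))
    (X0 : EuclideanSpace ℝ (Fin mx × Fin nx)) (Y0 : EuclideanSpace ℝ (Fin my × Fin ny))
    (hX0 : Xg 0 = fun _ => X0) (hY0 : Yg 0 = fun _ => Y0)
    (hminit : StronglyMeasurable Uinit ∧ StronglyMeasurable Vinit ∧
      StronglyMeasurable gXinit ∧ StronglyMeasurable gYinit ∧
      (∀ n, StronglyMeasurable (gXlinit n)) ∧ (∀ n, StronglyMeasurable (gYlinit n)))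
    (hinitint : Integrable Uinit μ ∧ Integrable Vinit μ ∧ Integrable gXinit μ ∧
      Integrable gYinit μ ∧ (∀ n, Integrable (gXlinit n) μ) ∧
      (∀ n, Integrable (gYlinit n) μ))
    -- algorithm dynamics: Muon local updates via a reduced SVD of the local momentum
    (hXl0 : ∀ n t, Xl n t 0 = Xg t) (hYl0 : ∀ n t, Yl n t 0 = Yg t)
    (hXlS : ∀ n t i, i < p → ∀ ω, ∃ (r : ℕ) (P : Matrix (Fin mx) (Fin r) ℝ)
      (Q : Matrix (Fin nx) (Fin r) ℝ) (sv : Fin r → ℝ),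
      Pᵀ * P = 1 ∧ Qᵀ * Q = 1 ∧ (∀ j, 0 < sv j) ∧
      euclToMatrix (Ul n t i ω) = P * Matrix.diagonal sv * Qᵀ ∧
      euclToMatrix (Xl n t (i + 1) ω) = euclToMatrix (Xl n t i ω) - etax • (P * Qᵀ))
    (hYlS : ∀ n t i, i < p → ∀ ω, ∃ (r : ℕ) (R : Matrix (Fin my) (Fin r) ℝ)
      (S : Matrix (Fin ny) (Fin r) ℝ) (sv : Fin r → ℝ),
      Rᵀ * R = 1 ∧ Sᵀ * S = 1 ∧ (∀ j, 0 < sv j) ∧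
      euclToMatrix (Vl n t i ω) = R * Matrix.diagonal sv * Sᵀ ∧
      euclToMatrix (Yl n t (i + 1) ω) = euclToMatrix (Yl n t i ω) + etay • (R * Sᵀ))
    -- local momenta with control variates (round 0 uses the initial values)
    (hUl0 : ∀ n i, Ul n 0 i =
      fun ω => betax • (Dx n 0 i ω + gXinit ω - gXlinit n ω) + (1 - betax) • Uinit ω)
    (hUlS : ∀ n t i, Ul n (t + 1) i =
      fun ω => betax • (Dx n (t + 1) i ω + gXg t ω - gXl n t ω) + (1 - betax) • Ug t ω)
    (hVl0 : ∀ n i, Vl n 0 i =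
      fun ω => betay • (Dy n 0 i ω + gYinit ω - gYlinit n ω) + (1 - betay) • Vinit ω)
    (hVlS : ∀ n t i, Vl n (t + 1) i =
      fun ω => betay • (Dy n (t + 1) i ω + gYg t ω - gYl n t ω) + (1 - betay) • Vg t ω)
    -- control variates
    (hgXl : ∀ n t, gXl n t = fun ω => (p : ℝ)⁻¹ • ∑ i ∈ Finset.range p, Dx n t i ω)
    (hgYl : ∀ n t, gYl n t = fun ω => (p : ℝ)⁻¹ • ∑ i ∈ Finset.range p, Dy n t i ω)
    (hgXg : ∀ t, gXg t = fun ω => (N : ℝ)⁻¹ • ∑ n, gXl n t ω)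
    (hgYg : ∀ t, gYg t = fun ω => (N : ℝ)⁻¹ • ∑ n, gYl n t ω)
    -- global updates and global momenta
    (hXgS : ∀ t, Xg (t + 1) =
      fun ω => Xg t ω + (gammax / (etax * N * p)) • ∑ n, (Xl n t p ω - Xg t ω))
    (hYgS : ∀ t, Yg (t + 1) =
      fun ω => Yg t ω + (gammay / (etay * N * p)) • ∑ n, (Yl n t p ω - Yg t ω))
    (hUg0 : Ug 0 = fun ω => betax • gXg 0 ω + (1 - betax) • Uinit ω)
    (hUgS : ∀ t, Ug (t + 1) = fun ω => betax • gXg (t + 1) ω + (1 - betax) • Ug t ω)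
    (hVg0 : Vg 0 = fun ω => betay • gYg 0 ω + (1 - betay) • Vinit ω)
    (hVgS : ∀ t, Vg (t + 1) = fun ω => betay • gYg (t + 1) ω + (1 - betay) • Vg t ω)
    -- Assumption 3 (heavy-tailed noise): the stochastic gradients are integrable,
    -- adapted to the filtration indexed lexicographically by (round, local step,
    -- client), conditionally unbiased, and have bounded s-th noise moment
    (hDxint : ∀ n t i, Integrable (Dx n t i) μ)
    (hDyint : ∀ n t i, Integrable (Dy n t i) μ)
    (hDxadapt : ∀ (n : Fin N) (t i : ℕ),
      StronglyMeasurable[F ((t * p + i) * N + (n : ℕ) + 1)] (Dx n t i))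
    (hDyadapt : ∀ (n : Fin N) (t i : ℕ),
      StronglyMeasurable[F ((t * p + i) * N + (n : ℕ) + 1)] (Dy n t i))
    (hiteradapt : ∀ (n : Fin N) (t i : ℕ),
      StronglyMeasurable[F ((t * p + i) * N)] (Xl n t i) ∧
      StronglyMeasurable[F ((t * p + i) * N)] (Yl n t i))
    (hunbx : ∀ (n : Fin N) (t i : ℕ),
      μ[fun ω => Dx n t i ω - Gx n (Xl n t i ω) (Yl n t i ω)|F ((t * p + i) * N + (n : ℕ))]
        =ᵐ[μ] 0)
    (hunby : ∀ (n : Fin N) (t i : ℕ),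
      μ[fun ω => Dy n t i ω - Gy n (Xl n t i ω) (Yl n t i ω)|F ((t * p + i) * N + (n : ℕ))]
        =ᵐ[μ] 0)
    (hmomx : ∀ (n : Fin N) (t i : ℕ),
      ∫ ω, ‖Dx n t i ω - Gx n (Xl n t i ω) (Yl n t i ω)‖ ^ s ∂μ ≤ sigma ^ s)
    (hmomy : ∀ (n : Fin N) (t i : ℕ),
      ∫ ω, ‖Dy n t i ω - Gy n (Xl n t i ω) (Yl n t i ω)‖ ^ s ∂μ ≤ sigma ^ s) :
    ∀ t : ℕ,
      (∫ ω, Phi (Xg (t + 1) ω) ∂μ) - ∫ ω, Phi (Xg t ω) ∂μ ≤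
        -(gammax * ∫ ω, ‖GPhi (Xg t ω)‖ ∂μ)
        + 2 * gammax * (Lf / mupl) * Real.sqrt nx * ∫ ω, ‖Gybar (Xg t ω) (Yg t ω)‖ ∂μ
        + 2 * gammax * Real.sqrt nx * ∫ ω, ‖Gxbar (Xg t ω) (Yg t ω) - Ug t ω‖ ∂μ
        + 2 * gammax * Real.sqrt nx * (((1 : ℝ) / (N * p)) *
            ∑ n : Fin N, ∑ i ∈ Finset.range p, ∫ ω, ‖Ug t ω - Ul n t i ω‖ ∂μ)
        + (Lf + Lf ^ 2 / mupl) * nx * gammax ^ 2 / 2 := by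
  have hGxb : ∀ X Y, HasGradientAt (fun X' => fbar X' Y) (Gxbar X Y) X := fun X Y => by
    simp only [hfbar, hGxbar]
    exact HasGradientAt.const_mul_sum _ fun n => hGx n X Y
  have hGyb : ∀ X Y, HasGradientAt (fbar X) (Gybar X Y) Y := fun X Y => by
    rw [hGybar, show fbar X = fun Y' => (N : ℝ)⁻¹ * ∑ n, f n X Y' from funext (hfbar X)]
    exact HasGradientAt.const_mul_sum _ fun n => hGy n X Y
  have hLx : ∀ X Y X' Y', ‖Gxbar X Y - Gxbar X' Y'‖ ≤
      Lf * √(‖X - X'‖ ^ 2 + ‖Y - Y'‖ ^ 2) := fun X Y X' Y' => by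
    rw [hGxbar, hGxbar]
    exact norm_average_sub_average_le hN fun n =>
      (Real.le_sqrt_of_sq_le (le_add_of_nonneg_right (sq_nonneg _))).trans (hLip n X Y X' Y')
  have hLy : ∀ X Y X' Y', ‖Gybar X Y - Gybar X' Y'‖ ≤
      Lf * √(‖X - X'‖ ^ 2 + ‖Y - Y'‖ ^ 2) := fun X Y X' Y' => by
    rw [hGybar, hGybar]
    exact norm_average_sub_average_le hN fun n =>
      (Real.le_sqrt_of_sq_le (le_add_of_nonneg_left (sq_nonneg _))).trans (hLip n X Y X' Y')
  have hLxx : ∀ X X' Y, ‖Gxbar X Y - Gxbar X' Y‖ ≤ Lf * ‖X - X'‖ := fun X X' Y => by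
    simpa using hLx X Y X' Y
  have hLxy : ∀ X Y Y', ‖Gxbar X Y - Gxbar X Y'‖ ≤ Lf * ‖Y - Y'‖ := fun X Y Y' => by
    simpa using hLx X Y X Y'
  have hLyx : ∀ X X' Y, ‖Gybar X Y - Gybar X' Y‖ ≤ Lf * ‖X - X'‖ := fun X X' Y => by
    simpa using hLy X Y X' Y
  simp only [← hPhi] at hYstar hPL
  have hgap := norm_primal_gradient_sub_le hLf hmupl hGxb hGyb hLxy hYstar hPL hGPhi
  have hquad := primal_le_quadratic hmupl hGxb hGyb hLxx hLyx hYstar (fun X => (hPhi X).symm)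
    hPL hGPhi
  have hPhic : Continuous Phi := continuous_iff_continuousAt.2 fun X => (hGPhi X).continuousAt
  have hGPhic : Continuous GPhi :=
    continuous_primal_gradient hLf hmupl hGxb hGyb hLxx hLyx hYstar (fun X => (hPhi X).symm)
      hGPhi hgap
  have hXdir := fun t ω => exists_muon_directions hp hN hetax.ne' (γ := gammax)
    (U := fun n i => Ul n t i ω) (X := fun n i => Xl n t i ω)
    (fun n => congrFun (hXl0 n t) ω) (fun n i hi => hXlS n t i hi ω) (congrFun (hXgS t) ω)
  have hYdir := fun t ω => exists_muon_directions hp hN (neg_ne_zero.2 hetay.ne') (γ := -gammay)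
    (U := fun n i => Vl n t i ω) (X := fun n i => Yl n t i ω)
    (fun n => congrFun (hYl0 n t) ω)
    (fun n i hi => by simpa only [neg_smul, sub_neg_eq_add] using hYlS n t i hi ω)
    ((congrFun (hYgS t) ω).trans (by simp only [neg_mul, neg_div_neg_eq]))
  have hXinc : ∀ t ω, ‖Xg (t + 1) ω - Xg t ω‖ ≤ gammax * √nx := fun t ω => by
    obtain ⟨D, hD, hx⟩ := hXdir t ω
    rw [hx, norm_neg]
    exact norm_average_double_sum_le hN hp hgammax fun n i hi => (hD n i hi).1
  have hYinc : ∀ t ω, ‖Yg (t + 1) ω - Yg t ω‖ ≤ gammay * √ny := fun t ω => by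
    obtain ⟨D, hD, hy⟩ := hYdir t ω
    rw [hy, neg_div, neg_smul, neg_neg]
    exact norm_average_double_sum_le hN hp hgammay fun n i hi => (hD n i hi).1
  have hXm : ∀ t, StronglyMeasurable (Xg t) := fun t =>
    hXl0 ⟨0, hN⟩ t ▸ (hiteradapt ⟨0, hN⟩ t 0).1.mono (F.le _)
  have hYm : ∀ t, StronglyMeasurable (Yg t) := fun t =>
    hYl0 ⟨0, hN⟩ t ▸ (hiteradapt ⟨0, hN⟩ t 0).2.mono (F.le _)
  have hgXlint : ∀ n t, Integrable (gXl n t) μ := fun n t => by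
    rw [hgXl]
    exact Integrable.smul (p : ℝ)⁻¹ (integrable_finsetSum _ fun i _ => hDxint n t i)
  have hgXgint : ∀ t, Integrable (gXg t) μ := fun t => by
    rw [hgXg]
    exact Integrable.smul (N : ℝ)⁻¹ (integrable_finsetSum _ fun n _ => hgXlint n t)
  have hUgint : ∀ t, Integrable (Ug t) μ := fun t => by
    induction t with
    | zero => rw [hUg0]; exact integrable_smul_add_smul (hgXgint 0) hinitint.1 _ _
    | succ t ih => rw [hUgS]; exact integrable_smul_add_smul (hgXgint _) ih _ _
  have hUlint : ∀ n t i, Integrable (Ul n t i) μ := fun n t i => by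
    cases t with
    | zero =>
      rw [hUl0]
      exact integrable_smul_add_smul
        (((hDxint n 0 i).add hinitint.2.2.1).sub (hinitint.2.2.2.2.1 n)) hinitint.1 _ _
    | succ t =>
      rw [hUlS]
      exact integrable_smul_add_smul
        (((hDxint n _ i).add (hgXgint t)).sub (hgXlint n t)) (hUgint t) _ _
  have hXb := norm_iterate_bounded hX0 hXinc
  have hYb := norm_iterate_bounded hY0 hYinc
  have hPhiint : ∀ t, Integrable (fun ω => Phi (Xg t ω)) μ := fun t =>
    hPhic.integrable_comp_of_bounded (hXm t) (hXb t).choose_spec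
  intro t
  obtain ⟨BX, hBX⟩ := hXb t
  obtain ⟨BY, hBY⟩ := hYb t
  have hXYm : StronglyMeasurable fun ω => (Xg t ω, Yg t ω) := (hXm t).prodMk (hYm t)
  have hXYb : ∀ ω, ‖(Xg t ω, Yg t ω)‖ ≤ max BX BY := fun ω => max_le_max (hBX ω) (hBY ω)
  have hGPhiint : Integrable (fun ω => ‖GPhi (Xg t ω)‖) μ :=
    (hGPhic.integrable_comp_of_bounded (hXm t) hBX).norm
  have hGyint : Integrable (fun ω => ‖Gybar (Xg t ω) (Yg t ω)‖) μ :=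
    ((continuous_uncurry_of_norm_sub_le hLf.le hLy).integrable_comp_of_bounded hXYm hXYb).norm
  have hGxint : Integrable (fun ω => ‖Gxbar (Xg t ω) (Yg t ω) - Ug t ω‖) μ :=
    (((continuous_uncurry_of_norm_sub_le hLf.le hLx).integrable_comp_of_bounded hXYm hXYb).sub
      (hUgint t)).norm
  have hUint : ∀ n i, Integrable (fun ω => ‖Ug t ω - Ul n t i ω‖) μ := fun n i =>
    ((hUgint t).sub (hUlint n t i)).norm
  have hpoint : ∀ ω, Phi (Xg (t + 1) ω) - Phi (Xg t ω) ≤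
      -(gammax * ‖GPhi (Xg t ω)‖)
        + 2 * gammax * (Lf / mupl) * √nx * ‖Gybar (Xg t ω) (Yg t ω)‖
        + 2 * gammax * √nx * ‖Gxbar (Xg t ω) (Yg t ω) - Ug t ω‖
        + 2 * gammax * √nx * (((1 : ℝ) / (N * p)) *
            ∑ n : Fin N, ∑ i ∈ Finset.range p, ‖Ug t ω - Ul n t i ω‖)
        + (Lf + Lf ^ 2 / mupl) * nx * gammax ^ 2 / 2 := fun ω => by
    obtain ⟨D, hD, hx⟩ := hXdir t ω
    have h1 := hquad (Xg t ω) (Xg (t + 1) ω)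
    have h2 : ‖Xg (t + 1) ω - Xg t ω‖ ^ 2 ≤ gammax ^ 2 * nx := by
      calc ‖Xg (t + 1) ω - Xg t ω‖ ^ 2 ≤ (gammax * √nx) ^ 2 := by gcongr; exact hXinc t ω
        _ = gammax ^ 2 * nx := by rw [mul_pow, Real.sq_sqrt (Nat.cast_nonneg _)]
    have h3 : (Lf + Lf ^ 2 / mupl) / 2 * ‖Xg (t + 1) ω - Xg t ω‖ ^ 2 ≤
        (Lf + Lf ^ 2 / mupl) / 2 * (gammax ^ 2 * nx) := by gcongr
    have h4 := inner_neg_average_le hN hp hgammax (Real.sqrt_nonneg nx)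
      (hgap (Xg t ω) (Yg t ω)) (u := Ug t ω) (D := D) (U := fun n i => Ul n t i ω)
      fun n i hi => neg_inner_le_of_muon_direction (hD n i hi).1 (hD n i hi).2
    rw [← hx] at h4
    linarith
  exact integral_sub_le_of_forall_le (hPhiint t) (hPhiint (t + 1)) hGPhiint hGyint hGxint hUint
    hpoint
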